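/- Let n ≥ 3 be an integer, let p be a prime number, and let k be any integer. Then there exist a, b ∈ ℚ such that the trinomial f = Xⁿ + aX + b ∈ ℚ[X] is separable with splitting field K satisfying: the Galois group Gal(K/ℚ) is isomorphic to the symmetric group Sₙ, and the reduced discriminant of the number field K is congruent to k modulo p. (This holds unconditionally, with no exceptional primes p.) -/

import Mathlib

open Polynomial

/-- The reduced discriminant of a number field: the product of the distinct prime
numbers dividing its discriminant (equivalently, the ramified primes). -/
noncomputable def reducedDiscr (K : Type*) [Field K] [NumberField K] : ℕ :=
  ∏ q ∈ (NumberField.discr K).natAbs.primeFactors, q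

open NumberField

section Ramification

variable {K : Type*} [Field K]

theorem under_int_eq_span {q : ℕ} (hq : q.Prime) (P : Ideal (𝓞 K)) [P.IsPrime]
    (h : (q : 𝓞 K) ∈ P) : P.under ℤ = Ideal.span {(q : ℤ)} := by
  have := (Ideal.liesOver_span_iff (P := P) (p := (q : ℤ)) (Ideal.IsPrime.ne_top ‹_›)
    (Nat.prime_iff_prime_int.mp hq)).mpr (by simpa using h)
  exact this.over.symm

theorem intCast_mem_iff {q : ℕ} (hq : q.Prime) {P : Ideal (𝓞 K)} [P.IsPrime]
    (h : (q : 𝓞 K) ∈ P) {z : ℤ} : (z : 𝓞 K) ∈ P ↔ (q : ℤ) ∣ z := by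
  rw [← Ideal.mem_span_singleton, ← under_int_eq_span hq P h, Ideal.under, Ideal.mem_comap]
  simp

theorem natCast_mem_iff {q : ℕ} (hq : q.Prime) {P : Ideal (𝓞 K)} [P.IsPrime]
    (h : (q : 𝓞 K) ∈ P) {m : ℕ} : (m : 𝓞 K) ∈ P ↔ q ∣ m := by
  rw [← Int.natCast_dvd_natCast, ← intCast_mem_iff hq h, Int.cast_natCast]

theorem card_quotient_under {q : ℕ} (hq : q.Prime) {P : Ideal (𝓞 K)} [P.IsPrime]
    (h : (q : 𝓞 K) ∈ P) : Nat.card (ℤ ⧸ P.under ℤ) = q := by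
  rw [under_int_eq_span hq P h, ← Submodule.cardQuot_apply, ← Ideal.absNorm_apply]
  simp

variable [NumberField K]

theorem inertia_eq_bot_iff_isUnramifiedAt [IsGalois ℚ K] (P : Ideal (𝓞 K)) [P.IsPrime] :
    P.inertia (K ≃ₐ[ℚ] K) = ⊥ ↔ Algebra.IsUnramifiedAt ℤ P := by
  rw [← Ideal.ramificationIdx_eq_one_iff (R := ℤ), ← Subgroup.card_eq_one,
    Ideal.card_inertia_eq_ramificationIdxIn (G := K ≃ₐ[ℚ] K) (P.under ℤ) P,
    Ideal.ramificationIdxIn_eq_ramificationIdx (P.under ℤ) P (K ≃ₐ[ℚ] K)]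

theorem not_isUnramifiedAt_of_mem_sq {q : ℕ} (hq : q.Prime) (P : Ideal (𝓞 K)) [P.IsPrime]
    (h : (q : 𝓞 K) ∈ P ^ 2) : ¬ Algebra.IsUnramifiedAt ℤ P := by
  have hu := under_int_eq_span hq P (Ideal.pow_le_self two_ne_zero h)
  have h0 : P.under ℤ ≠ ⊥ := by simp [hu, hq.ne_zero]
  have hmap : (P.under ℤ).map (algebraMap ℤ (𝓞 K)) ≤ P ^ 2 := by
    rw [hu, Ideal.map_span, Ideal.span_le]
    simpa using h
  rw [← Ideal.ramificationIdx_eq_one_iff (R := ℤ),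
    ← Ideal.ramificationIdx'_eq_ramificationIdx (P.under ℤ) P h0]
  exact (Ideal.ramificationIdx'_ne_one_iff (hmap.trans (Ideal.pow_le_self two_ne_zero))).mpr hmap

theorem dvd_discr_of_mem_sq {q : ℕ} (hq : q.Prime) (P : Ideal (𝓞 K)) [P.IsPrime]
    (h : (q : 𝓞 K) ∈ P ^ 2) : (q : ℤ) ∣ discr K := by
  by_contra hn
  rw [not_dvd_discr_iff_forall_mem K (𝓞 K) (Nat.prime_iff_prime_int.mp hq)] at hn
  exact not_isUnramifiedAt_of_mem_sq hq P h
    (hn P ‹_› (by simpa using Ideal.pow_le_self two_ne_zero h))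

theorem not_dvd_discr_of_inertia_eq_bot [IsGalois ℚ K] {q : ℕ} (hq : q.Prime)
    (h : ∀ P : Ideal (𝓞 K), P.IsPrime → (q : 𝓞 K) ∈ P → P.inertia (K ≃ₐ[ℚ] K) = ⊥) :
    ¬ (q : ℤ) ∣ discr K := by
  rw [not_dvd_discr_iff_forall_mem K (𝓞 K) (Nat.prime_iff_prime_int.mp hq)]
  intro P hP hqP
  rw [← inertia_eq_bot_iff_isUnramifiedAt]
  exact h P hP (by simpa using hqP)

theorem exists_isPrime_natCast_mem {q : ℕ} (hq : q.Prime) :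
    ∃ P : Ideal (𝓞 K), P.IsPrime ∧ (q : 𝓞 K) ∈ P := by
  have hqZ := Nat.prime_iff_prime_int.mp hq
  have : (Ideal.span {(q : ℤ)}).IsPrime :=
    (Ideal.span_singleton_prime hqZ.ne_zero).mpr hqZ
  obtain ⟨P, hP, hover⟩ := Ideal.nonempty_primesOver (P := Ideal.span {(q : ℤ)}) (S := 𝓞 K)
  refine ⟨P, hP, ?_⟩
  simpa using (Ideal.liesOver_span_iff hP.ne_top hqZ).mp hover

theorem pow_dvd_of_natCast_mem_pow {q : ℕ} (hq : q.Prime) {P : Ideal (𝓞 K)} [P.IsPrime]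
    (h : (q : 𝓞 K) ∈ P) (h2 : (q : 𝓞 K) ∉ P ^ 2) {k m : ℕ} (hm : (m : 𝓞 K) ∈ P ^ k) :
    q ^ k ∣ m := by
  induction k generalizing m with
  | zero => simp
  | succ k ih =>
    obtain ⟨v, rfl⟩ := (natCast_mem_iff hq h).mp (Ideal.pow_le_self k.succ_ne_zero hm)
    rw [pow_succ']
    refine mul_dvd_mul_left q (ih ?_)
    obtain ⟨J, hJ⟩ := Ideal.dvd_span_singleton.mpr h
    have hP0 : P ≠ ⊥ := by rintro rfl; simp [hq.ne_zero] at h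
    have hJP : ¬ J ≤ P := by
      intro hle
      apply h2
      rw [← Ideal.dvd_span_singleton, hJ, pow_two]
      exact mul_dvd_mul_left P (Ideal.dvd_iff_le.mpr hle)
    obtain ⟨j, hj, hjP⟩ := SetLike.not_le_iff_exists.mp hJP
    have hd : P * P ^ k ∣ P * (J * Ideal.span {(v : 𝓞 K)}) := by
      rw [← mul_assoc, ← hJ, Ideal.span_singleton_mul_span_singleton, ← pow_succ',
        Ideal.dvd_span_singleton]
      simpa using hm
    have hle := Ideal.dvd_iff_le.mp ((mul_dvd_mul_iff_left hP0).mp hd)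
    have hjv := hle (Ideal.mul_mem_mul hj (Ideal.mem_span_singleton_self (v : 𝓞 K)))
    exact (Ideal.IsPrime.mul_mem_pow P hjv).resolve_left hjP

theorem finite_quotient_of_natCast_mem {q : ℕ} (hq : q.Prime) {P : Ideal (𝓞 K)} [P.IsPrime]
    (h : (q : 𝓞 K) ∈ P) : Finite (𝓞 K ⧸ P) := by
  refine Ideal.finiteQuotientOfFreeOfNeBot P ?_
  rintro rfl
  simp [hq.ne_zero] at h

end Ramification

/-- The Galois group of the splitting field of a monic irreducible integral polynomial permutes the
integral roots faithfully and transitively. -/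
theorem exists_roots_and_permHom {K : Type*} [Field K] [NumberField K] {n : ℕ} {F : ℤ[X]}
    (hF : F.Monic) (hn : F.natDegree = n) (hirr : Irreducible (F.map (Int.castRingHom ℚ)))
    [IsSplittingField ℚ K (F.map (Int.castRingHom ℚ))] :
    ∃ (y : Fin n → 𝓞 K) (φ : (K ≃ₐ[ℚ] K) →* Equiv.Perm (Fin n)),
      F.map (Int.castRingHom (𝓞 K)) = ∏ i, (X - C (y i)) ∧ Function.Injective φ ∧
      (∀ σ i, σ • y i = y (φ σ i)) ∧ ∀ i j, ∃ σ, φ σ i = j := by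
  classical
  set f := F.map (Int.castRingHom ℚ) with hf
  have hfm : f.Monic := hF.map _
  have hfK : f.map (algebraMap ℚ K) = F.map (Int.castRingHom K) := by
    rw [hf, Polynomial.map_map]; congr 1; exact RingHom.ext_int _ _
  have hsplit := IsSplittingField.splits K f
  have hsep : (f.map (algebraMap ℚ K)).Separable := hirr.separable.map
  have hnodup := nodup_roots hsep
  have hcard : Fintype.card (f.rootSet K) = n := by
    rw [Polynomial.card_rootSet_eq_natDegree hirr.separable hsplit, hf, hF.natDegree_map, hn]
  let e : Fin n ≃ f.rootSet K := (Fintype.equivFinOfCardEq hcard).symm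
  have hroot : ∀ i, aeval (e i : K) f = 0 := fun i ↦ aeval_eq_zero_of_mem_rootSet (e i).2
  have hint : ∀ i, IsIntegral ℤ (e i : K) := fun i ↦ by
    refine ⟨F, hF, ?_⟩
    have := hroot i
    rwa [aeval_def, ← eval_map, hfK, eval_map] at this
  let y : Fin n → 𝓞 K := fun i ↦ ⟨e i, hint i⟩
  have hy : ∀ i, ((y i : 𝓞 K) : K) = e i := fun i ↦ rfl
  have hyinj : Function.Injective y := fun i j h ↦ by
    apply e.injective; apply Subtype.ext
    rw [← hy, h, hy]
  have hprodK : F.map (Int.castRingHom K) = ∏ i, (X - C ((y i : 𝓞 K) : K)) := by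
    rw [← hfK, hsplit.eq_prod_roots, (hfm.map _).leadingCoeff, C_1, one_mul]
    have : ∏ i, (X - C ((y i : 𝓞 K) : K)) = ∏ z : f.rootSet K, (X - C (z : K)) :=
      Fintype.prod_equiv e _ _ fun i ↦ by rw [hy]
    rw [this]
    refine Eq.trans ?_ (Finset.prod_coe_sort (f.aroots K).toFinset fun z ↦ X - C z).symm
    rw [Finset.prod, Multiset.toFinset_val, Multiset.dedup_eq_self.mpr hnodup]
  have hprod : F.map (Int.castRingHom (𝓞 K)) = ∏ i, (X - C (y i)) := by
    apply Polynomial.map_injective (algebraMap (𝓞 K) K) RingOfIntegers.coe_injective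
    rw [Polynomial.map_map, RingHom.ext_int ((algebraMap (𝓞 K) K).comp _) (Int.castRingHom K),
      hprodK, Polynomial.map_prod]
    simp
  have hex : ∀ (σ : K ≃ₐ[ℚ] K) i, ∃ j, y j = σ • y i := fun σ i ↦ by
    have h : σ (e i) ∈ f.rootSet K := by
      rw [mem_rootSet_of_ne hfm.ne_zero]
      have := congrArg σ (hroot i)
      rwa [map_zero, ← AlgEquiv.coe_toAlgHom, ← aeval_algHom_apply] at this
    refine ⟨e.symm ⟨_, h⟩, RingOfIntegers.coe_injective ?_⟩
    change ((y _ : 𝓞 K) : K) = σ (y i : K)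
    rw [hy, hy, e.apply_symm_apply]
  choose ρ hρ using hex
  let act : MulAction (K ≃ₐ[ℚ] K) (Fin n) :=
    { smul := ρ
      one_smul := fun i ↦ hyinj (by change y (ρ 1 i) = _; rw [hρ, one_smul])
      mul_smul := fun σ τ i ↦ hyinj (by
        change y (ρ _ i) = y (ρ σ (ρ τ i)); rw [hρ, hρ, hρ, mul_smul]) }
  refine ⟨y, MulAction.toPermHom _ _, hprod, ?_, fun σ i ↦ (hρ σ i).symm, fun i j ↦ ?_⟩
  · rw [injective_iff_map_eq_one]
    intro σ hσ
    have hfix : ∀ z ∈ f.rootSet K, σ z = z := fun z hz ↦ by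
      have h1 : ρ σ (e.symm ⟨z, hz⟩) = e.symm ⟨z, hz⟩ := DFunLike.congr_fun hσ _
      have h2 := congrArg (fun t : 𝓞 K ↦ (t : K)) (hρ σ (e.symm ⟨z, hz⟩))
      rw [h1] at h2
      change ((y _ : 𝓞 K) : K) = σ (y _ : K) at h2
      rw [hy, e.apply_symm_apply] at h2
      exact h2.symm
    have htop := IsSplittingField.adjoin_rootSet K f
    have : (σ : K →ₐ[ℚ] K) = AlgHom.id ℚ K := by
      apply AlgHom.ext_of_adjoin_eq_top htop
      exact fun z hz ↦ hfix z hz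
    ext z
    exact DFunLike.congr_fun this z
  · have hn' : Normal ℚ K := Normal.of_isSplittingField f
    have hmin : minpoly ℚ (e i : K) = minpoly ℚ (e j : K) := by
      rw [← minpoly.eq_of_irreducible_of_monic hirr (hroot i) hfm,
        ← minpoly.eq_of_irreducible_of_monic hirr (hroot j) hfm]
    obtain ⟨σ, hσ⟩ := (Normal.minpoly_eq_iff_mem_orbit K).mp hmin.symm
    refine ⟨σ, hyinj ?_⟩
    change y (ρ σ i) = y j
    rw [hρ]
    exact RingOfIntegers.coe_injective hσ

/-- A transitive permutation group containing a transposition and acting transitively on the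
complement of a point through elements fixing that point is the full symmetric group. -/
theorem eq_top_of_swap_mem_of_transitive {α : Type*} [DecidableEq α] [Finite α]
    (G : Subgroup (Equiv.Perm α)) (htrans : ∀ i j, ∃ σ ∈ G, σ i = j)
    {a b : α} (hab : a ≠ b) (hswap : Equiv.swap a b ∈ G) (c : α)
    (hc : ∀ i j, i ≠ c → j ≠ c → ∃ σ ∈ G, σ c = c ∧ σ i = j) : G = ⊤ := by
  have hconj : ∀ σ ∈ G, ∀ i j, Equiv.swap i j ∈ G → Equiv.swap (σ i) (σ j) ∈ G := by
    intro σ hσ i j h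
    rw [Equiv.swap_apply_apply]
    exact G.mul_mem (G.mul_mem hσ h) (G.inv_mem hσ)
  obtain ⟨σ, hσ, hσa⟩ := htrans a c
  have h1 : Equiv.swap c (σ b) ∈ G := hσa ▸ hconj σ hσ a b hswap
  have hσb : σ b ≠ c := fun h ↦ hab (σ.injective (hσa.trans h.symm))
  have h2 : ∀ j, j ≠ c → Equiv.swap c j ∈ G := by
    intro j hj
    obtain ⟨τ, hτ, hτc, hτj⟩ := hc (σ b) j hσb hj
    have := hconj τ hτ _ _ h1
    rwa [hτc, hτj] at this
  rw [eq_top_iff, ← Equiv.Perm.closure_isSwap, Subgroup.closure_le]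
  rintro _ ⟨i, j, hij, rfl⟩
  by_cases hi : i = c
  · exact hi ▸ h2 j (fun h ↦ hij (hi.trans h.symm))
  by_cases hj : j = c
  · rw [Equiv.swap_comm]; exact hj ▸ h2 i hi
  · have := hconj _ (h2 i hi) _ _ (h2 j hj)
    rwa [Equiv.swap_apply_left, Equiv.swap_apply_of_ne_of_ne hj (Ne.symm hij)] at this

/-- The trinomial `X ^ (N + 1) + A X + A r`. -/
noncomputable def twoParamTrinomial (N : ℕ) (A r : ℤ) : ℤ[X] :=
  X ^ (N + 1) + C A * X + C (A * r)

section Trinomial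

variable {R : Type*} [CommRing R] {N : ℕ} {A r : ℤ} {y : Fin (N + 1) → R}

theorem prod_sub_eq (h : (twoParamTrinomial N A r).map (Int.castRingHom R) = ∏ i, (X - C (y i)))
    (x : R) : ∏ i, (x - y i) = x ^ (N + 1) + A * x + A * r := by
  have := congrArg (eval x) h
  simp only [twoParamTrinomial, eval_prod] at this
  simpa using this.symm

theorem trinomial_root (h : (twoParamTrinomial N A r).map (Int.castRingHom R) =
    ∏ i, (X - C (y i))) (i : Fin (N + 1)) : y i ^ (N + 1) + A * y i + A * r = 0 := by
  rw [← prod_sub_eq h]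
  exact Finset.prod_eq_zero (Finset.mem_univ i) (sub_self _)

theorem prod_erase_sub_eq (h : (twoParamTrinomial N A r).map (Int.castRingHom R) =
    ∏ i, (X - C (y i))) (i : Fin (N + 1)) :
    ∏ j ∈ Finset.univ.erase i, (y i - y j) = (N + 1) * y i ^ N + A := by
  have := congrArg (fun p ↦ eval (y i) (derivative p)) h
  simp only [twoParamTrinomial] at this
  rw [← Finset.mul_prod_erase _ _ (Finset.mem_univ i), derivative_mul] at this
  simpa [eval_prod] using this.symm

theorem root_mul_derivative (h : (twoParamTrinomial N A r).map (Int.castRingHom R) =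
    ∏ i, (X - C (y i))) (i : Fin (N + 1)) :
    y i * ((N + 1) * y i ^ N + A) = -(A * (N * y i + (N + 1) * r)) := by
  linear_combination ((N : R) + 1) * trinomial_root h i

theorem derivative_mem_of_sub_mem (h : (twoParamTrinomial N A r).map (Int.castRingHom R) =
    ∏ i, (X - C (y i))) (P : Ideal R) {i j : Fin (N + 1)} (hij : i ≠ j) (hP : y i - y j ∈ P) :
    (N + 1) * y i ^ N + A ∈ P := by
  rw [← prod_erase_sub_eq h]
  have hj : j ∈ Finset.univ.erase i := Finset.mem_erase.mpr ⟨hij.symm, Finset.mem_univ j⟩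
  exact P.mem_of_dvd (Finset.dvd_prod_of_mem _ hj) hP

theorem exists_sub_mem_of_derivative_mem
    (h : (twoParamTrinomial N A r).map (Int.castRingHom R) = ∏ i, (X - C (y i)))
    (P : Ideal R) [P.IsPrime] {i : Fin (N + 1)} (hP : (N + 1) * y i ^ N + A ∈ P) :
    ∃ j, i ≠ j ∧ y i - y j ∈ P := by
  rw [← prod_erase_sub_eq h, Ideal.IsPrime.prod_mem_iff] at hP
  obtain ⟨j, hj, hP⟩ := hP
  exact ⟨j, (Finset.ne_of_mem_erase hj).symm, hP⟩

theorem prod_affine_roots_eq_of_field {L : Type*} [Field L] [CharZero L] {z : Fin (N + 1) → L}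
    {u : ℤ} (hN : N ≠ 0)
    (h : (twoParamTrinomial N ((-1) ^ N * u) r).map (Int.castRingHom L) = ∏ i, (X - C (z i))) :
    ∏ i, (N * z i + (N + 1) * r) =
      ((r * ((N + 1) ^ (N + 1) * r ^ N + N ^ N * u) : ℤ) : L) := by
  have hN' : (N : L) ≠ 0 := by exact_mod_cast hN
  have key := prod_sub_eq h (-((N + 1) * r / N))
  have h1 : ∏ i, (N * z i + (N + 1) * r) =
      (-(N : L)) ^ (N + 1) * ∏ i, (-((N + 1) * r / N) - z i) := by
    rw [← Fin.prod_const, ← Finset.prod_mul_distrib]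
    refine Finset.prod_congr rfl fun i _ ↦ ?_
    field_simp
    ring
  rw [h1, key]
  have h2 : ((-1 : L) ^ N) * (-1) ^ N = 1 := by rw [← mul_pow]; simp
  have h3 : (-(N : L)) ^ (N + 1) = (-1) ^ N * (-1) * (N ^ N * N) := by
    rw [neg_pow, pow_succ, pow_succ (N : L)]
  have h4 : (-(N : L)) ^ (N + 1) * (-((N + 1) * r / N)) ^ (N + 1) = ((N + 1) * r) ^ (N + 1) := by
    rw [← mul_pow]; congr 1; field_simp
  rw [mul_add, mul_add, h4, h3]
  push_cast
  field_simp
  rw [mul_pow]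
  linear_combination ((N : L) ^ N * u * r) * h2

theorem prod_affine_roots_eq [IsDomain R] [CharZero R] {u : ℤ} (hN : N ≠ 0)
    (h : (twoParamTrinomial N ((-1) ^ N * u) r).map (Int.castRingHom R) = ∏ i, (X - C (y i))) :
    ∏ i, (N * y i + (N + 1) * r) =
      ((r * ((N + 1) ^ (N + 1) * r ^ N + N ^ N * u) : ℤ) : R) := by
  have hinj := FaithfulSMul.algebraMap_injective R (FractionRing R)
  have : CharZero (FractionRing R) := charZero_of_injective_algebraMap hinj
  apply hinj
  rw [map_intCast, ← prod_affine_roots_eq_of_field (z := fun i ↦ algebraMap R (FractionRing R) (y i))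
    hN, map_prod]
  · simp
  · rw [← RingHom.ext_int ((algebraMap R (FractionRing R)).comp (Int.castRingHom R))
      (Int.castRingHom (FractionRing R)), ← Polynomial.map_map, h, Polynomial.map_prod]
    simp

theorem second_derivative_mem_of_triple
    (h : (twoParamTrinomial N A r).map (Int.castRingHom R) = ∏ i, (X - C (y i)))
    (P : Ideal R) {i j k : Fin (N + 1)} (hij : i ≠ j) (hik : i ≠ k) (hjk : j ≠ k)
    (hj : y i - y j ∈ P) (hk : y i - y k ∈ P) :
    ((N + 1) * N : R) * y i ^ (N - 1) ∈ P := by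
  let π := Ideal.Quotient.mk P
  have hj' : π (y j) = π (y i) := ((Ideal.Quotient.eq).mpr hj).symm
  have hk' : π (y k) = π (y i) := ((Ideal.Quotient.eq).mpr hk).symm
  have hm : (X ^ (N + 1) + C (A : R ⧸ P) * X + C ((A * r : ℤ) : R ⧸ P)) =
      ∏ i, (X - C (π (y i))) := by
    have := congrArg (map π) h
    simpa [twoParamTrinomial, Polynomial.map_prod] using this
  have hd : (X - C (π (y i))) ^ 3 ∣ ∏ i, (X - C (π (y i))) := by
    have hsub : ({i, j, k} : Finset (Fin (N + 1))) ⊆ Finset.univ := Finset.subset_univ _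
    refine dvd_trans (dvd_of_eq ?_) (Finset.prod_dvd_prod_of_subset _ _ _ hsub)
    rw [Finset.prod_insert (by simp [hij, hik]), Finset.prod_insert (by simp [hjk]),
      Finset.prod_singleton, hj', hk']
    ring
  rw [← hm] at hd
  have h2 := pow_sub_one_dvd_derivative_of_pow_dvd (pow_sub_one_dvd_derivative_of_pow_dvd hd)
  have h3 := eval_eq_zero_of_dvd_of_eval_eq_zero h2 (x := π (y i)) (by simp)
  rw [← Ideal.Quotient.eq_zero_iff_mem]
  change π _ = 0
  simp [derivative_X_pow] at h3
  simpa [mul_assoc] using h3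

end Trinomial

/-- Up to sign and the factor `A ^ N`, the discriminant of the trinomial
`X ^ (N + 1) + A X + A r` with `A = (-1) ^ N u`. -/
def trinomialDisc (N u r : ℕ) : ℕ := (N + 1) ^ (N + 1) * r ^ N + N ^ N * u

section Primes

variable {K : Type*} [Field K] {N u r q : ℕ} {y : Fin (N + 1) → 𝓞 K}

theorem affine_mem_of_sub_mem
    (h : (twoParamTrinomial N ((-1) ^ N * u) r).map (Int.castRingHom (𝓞 K)) =
      ∏ i, (X - C (y i))) (hq : q.Prime) (P : Ideal (𝓞 K)) [P.IsPrime] (hqP : (q : 𝓞 K) ∈ P)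
    (hqu : ¬ q ∣ u) {i j : Fin (N + 1)} (hij : i ≠ j) (hP : y i - y j ∈ P) :
    (N * y i + (N + 1) * r : 𝓞 K) ∈ P := by
  have h1 := P.mul_mem_left (y i) (derivative_mem_of_sub_mem h P hij hP)
  rw [root_mul_derivative h, neg_mem_iff] at h1
  refine (Ideal.IsPrime.mem_or_mem ‹_› (by simpa using h1)).resolve_left fun h2 ↦ hqu ?_
  rw [← natCast_mem_iff hq hqP]
  have h3 := P.mul_mem_left ((-1) ^ N) h2
  rwa [← mul_assoc, ← mul_pow, neg_one_mul, neg_neg, one_pow, one_mul] at h3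

theorem dvd_of_root_mem
    (h : (twoParamTrinomial N ((-1) ^ N * u) r).map (Int.castRingHom (𝓞 K)) =
      ∏ i, (X - C (y i))) (hq : q.Prime) (P : Ideal (𝓞 K)) [P.IsPrime] (hqP : (q : 𝓞 K) ∈ P)
    {i : Fin (N + 1)} (hP : y i ∈ P) : q ∣ u * r := by
  rw [← natCast_mem_iff hq hqP]
  have h1 := trinomial_root h i
  have h2 : ((u * r : ℕ) : 𝓞 K) = y i * (-(-1) ^ N * (y i ^ N + (-1) ^ N * u)) := by
    have h3 : ((-1 : 𝓞 K) ^ N) * (-1) ^ N = 1 := by rw [← mul_pow]; simp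
    push_cast at h1 ⊢
    linear_combination (-1) ^ N * h1 - (u * r : 𝓞 K) * h3
  rw [h2]
  exact P.mul_mem_right _ hP

variable [NumberField K]

theorem eq_of_sub_mem (hN : N ≠ 0)
    (h : (twoParamTrinomial N ((-1) ^ N * u) r).map (Int.castRingHom (𝓞 K)) =
      ∏ i, (X - C (y i))) (hr : r.Prime) (hrN : ¬ r ∣ N) (hru : ¬ r ∣ u) (hq : q.Prime)
    (P : Ideal (𝓞 K)) [P.IsPrime] (hqP : (q : 𝓞 K) ∈ P) (hqu : ¬ q ∣ u)
    (hqΔ : ¬ q ∣ trinomialDisc N u r) {i j : Fin (N + 1)} (hP : y i - y j ∈ P) : i = j := by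
  by_contra hij
  have h1 := affine_mem_of_sub_mem h hq P hqP hqu hij hP
  have h2 : ((r * trinomialDisc N u r : ℕ) : 𝓞 K) ∈ P := by
    have := prod_affine_roots_eq (u := u) (r := r) hN h
    rw [trinomialDisc]
    push_cast at this ⊢
    rw [← this]
    exact P.mem_of_dvd (Finset.dvd_prod_of_mem _ (Finset.mem_univ i)) h1
  rw [natCast_mem_iff hq hqP, hq.dvd_mul] at h2
  obtain rfl := (Nat.prime_dvd_prime_iff_eq hq hr).mp (h2.resolve_right hqΔ)
  have h3 : (N : 𝓞 K) * y i ∈ P := by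
    have := P.sub_mem h1 (P.mul_mem_left ((N : 𝓞 K) + 1) hqP)
    simpa using this
  have h4 := (Ideal.IsPrime.mem_or_mem ‹_› h3).resolve_left
    fun h4 ↦ hrN ((natCast_mem_iff hq hqP).mp h4)
  have h5 := derivative_mem_of_sub_mem h P hij hP
  have h6 : ((N : 𝓞 K) + 1) * y i ^ N ∈ P := P.mul_mem_left _ (P.pow_mem_of_mem h4 N (by omega))
  have h7 := (P.add_mem_iff_right h6).mp h5
  rw [intCast_mem_iff hq hqP, (isUnit_neg_one.pow N).dvd_mul_left, Int.natCast_dvd_natCast] at h7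
  exact hqu h7

theorem not_dvd_discr_of_not_dvd [IsGalois ℚ K] {φ : (K ≃ₐ[ℚ] K) →* Equiv.Perm (Fin (N + 1))}
    (hφ : Function.Injective φ) (hy : ∀ σ i, σ • y i = y (φ σ i)) (hN : N ≠ 0)
    (h : (twoParamTrinomial N ((-1) ^ N * u) r).map (Int.castRingHom (𝓞 K)) =
      ∏ i, (X - C (y i))) (hr : r.Prime) (hrN : ¬ r ∣ N) (hru : ¬ r ∣ u) (hq : q.Prime)
    (hqu : ¬ q ∣ u) (hqΔ : ¬ q ∣ trinomialDisc N u r) : ¬ (q : ℤ) ∣ discr K := by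
  refine not_dvd_discr_of_inertia_eq_bot hq fun P _ hqP ↦ (Subgroup.eq_bot_iff_forall _).mpr ?_
  intro σ hσ
  refine hφ (Equiv.ext fun i ↦ ?_)
  rw [map_one, Equiv.Perm.one_apply]
  refine eq_of_sub_mem hN h hr hrN hru hq P hqP hqu hqΔ ?_
  rw [← hy]
  exact hσ (y i)

theorem dvd_discr_of_dvd
    (h : (twoParamTrinomial N ((-1) ^ N * u) r).map (Int.castRingHom (𝓞 K)) =
      ∏ i, (X - C (y i))) (hN : 2 ≤ N) (hq : q.Prime) (hqr : ¬ q ∣ r) (hqu : q ∣ u)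
    (hqu3 : ¬ q ^ 3 ∣ u) : (q : ℤ) ∣ discr K := by
  by_contra hd
  obtain ⟨P, hP, hqP⟩ := exists_isPrime_natCast_mem (K := K) hq
  have hq2 : (q : 𝓞 K) ∉ P ^ 2 := fun h2 ↦ hd (dvd_discr_of_mem_sq hq P h2)
  have h0 := trinomial_root h 0
  have hu : (u : 𝓞 K) ∈ P := (natCast_mem_iff hq hqP).mpr hqu
  have h1 : y 0 ∈ P := by
    refine hP.mem_of_pow_mem (N + 1) ?_
    have : y 0 ^ (N + 1) = u * (-(-1) ^ N * (y 0 + r)) := by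
      push_cast at h0
      linear_combination h0
    rw [this]
    exact P.mul_mem_right _ hu
  refine hqu3 (pow_dvd_of_natCast_mem_pow hq hqP hq2 ?_)
  have h2 : (y 0 + r) * u ∈ P ^ 3 := by
    have h3 : ((-1 : 𝓞 K) ^ N) * (-1) ^ N = 1 := by rw [← mul_pow]; simp
    have : (y 0 + r) * u = y 0 ^ (N + 1) * -(-1) ^ N := by
      push_cast at h0
      linear_combination (-1) ^ N * h0 - (u * (y 0 + r) : 𝓞 K) * h3
    rw [this]
    exact Ideal.mul_mem_right _ _ (Ideal.pow_le_pow_right (by omega) (Ideal.pow_mem_pow h1 _))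
  refine (Ideal.IsPrime.mul_mem_pow P h2).resolve_left fun h4 ↦ hqr ?_
  exact (natCast_mem_iff hq hqP).mp ((P.add_mem_iff_right h1).mp h4)

theorem eq_swap_of_forall_ne {α : Type*} [DecidableEq α] {τ : Equiv.Perm α} {a b : α} (hτ : τ ≠ 1)
    (h : ∀ i, τ i ≠ i → i = a ∨ i = b) : τ = Equiv.swap a b := by
  have hab : ∀ i, τ i ≠ i → τ (τ i) ≠ τ i := fun i hi h2 ↦ hi (τ.injective h2)
  obtain ⟨i, hi⟩ : ∃ i, τ i ≠ i := by
    by_contra! hall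
    exact hτ (Equiv.ext hall)
  have h1 := h i hi
  have h2 := h _ (hab i hi)
  have h3 := h _ (hab _ (hab i hi))
  have h4 := hab i hi
  ext x
  have h5 := h x
  rw [Equiv.swap_apply_def]
  grind

/-- A prime exactly dividing `trinomialDisc N u r` ramifies, with inertia acting by a
transposition. -/
theorem exists_swap_of_dvd_trinomialDisc [IsGalois ℚ K]
    {φ : (K ≃ₐ[ℚ] K) →* Equiv.Perm (Fin (N + 1))}
    (hφ : Function.Injective φ) (hy : ∀ σ i, σ • y i = y (φ σ i)) (hN : N ≠ 0)
    (h : (twoParamTrinomial N ((-1) ^ N * u) r).map (Int.castRingHom (𝓞 K)) =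
      ∏ i, (X - C (y i))) (hq : q.Prime) (hqr : ¬ q ∣ r) (hqN : ¬ q ∣ N) (hqN' : ¬ q ∣ N + 1)
    (hqu : ¬ q ∣ u) (hqΔ : q ∣ trinomialDisc N u r) (hqΔ2 : ¬ q ^ 2 ∣ trinomialDisc N u r) :
    (q : ℤ) ∣ discr K ∧ ∃ σ a b, a ≠ b ∧ φ σ = Equiv.swap a b := by
  obtain ⟨P, hP, hqP⟩ := exists_isPrime_natCast_mem (K := K) hq
  have hprod : ∏ i, (N * y i + (N + 1) * r : 𝓞 K) = ((r * trinomialDisc N u r : ℕ) : 𝓞 K) := by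
    have := prod_affine_roots_eq (u := u) (r := r) hN h
    rw [trinomialDisc]
    push_cast at this ⊢
    rw [← this]
  have hroot (i) : y i ∉ P := fun hi ↦ by
    have := dvd_of_root_mem h hq P hqP hi
    rw [hq.dvd_mul] at this
    tauto
  have hNP : (N : 𝓞 K) ∉ P := fun h1 ↦ hqN ((natCast_mem_iff hq hqP).mp h1)
  have hNP' : ((N : 𝓞 K) + 1) ∉ P := fun h1 ↦ hqN' ((natCast_mem_iff hq hqP).mp (by simpa using h1))
  obtain ⟨a, ha⟩ : ∃ i, (N * y i + (N + 1) * r : 𝓞 K) ∈ P := by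
    have : ∏ i, (N * y i + (N + 1) * r : 𝓞 K) ∈ P := by
      rw [hprod, natCast_mem_iff hq hqP]
      exact hqΔ.mul_left r
    obtain ⟨i, -, hi⟩ := (Ideal.IsPrime.prod_mem_iff).mp this
    exact ⟨i, hi⟩
  obtain ⟨b, hab, habP⟩ : ∃ j, a ≠ j ∧ y a - y j ∈ P := by
    refine exists_sub_mem_of_derivative_mem h P ?_
    refine (hP.mem_or_mem (x := y a) ?_).resolve_left (hroot a)
    rw [root_mul_derivative h, neg_mem_iff]
    exact P.mul_mem_left _ (by simpa using ha)
  have hb : (N * y b + (N + 1) * r : 𝓞 K) ∈ P := by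
    have := P.sub_mem ha (P.mul_mem_left (N : 𝓞 K) habP)
    convert this using 1
    ring
  have hq2 : (q : 𝓞 K) ∈ P ^ 2 := by
    by_contra h2
    have h3 : ((r * trinomialDisc N u r : ℕ) : 𝓞 K) ∈ P ^ 2 := by
      rw [← hprod, ← Finset.mul_prod_erase _ _ (Finset.mem_univ a),
        ← Finset.mul_prod_erase _ _ (Finset.mem_erase.mpr ⟨hab.symm, Finset.mem_univ b⟩),
        ← mul_assoc, pow_two]
      exact Ideal.mul_mem_right _ _ (Ideal.mul_mem_mul ha hb)
    have h4 := pow_dvd_of_natCast_mem_pow hq hqP h2 h3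
    exact hqΔ2 (((hq.coprime_iff_not_dvd.mpr hqr).pow_left 2).dvd_of_dvd_mul_left h4)
  refine ⟨dvd_discr_of_mem_sq hq P hq2, ?_⟩
  have hI : P.inertia (K ≃ₐ[ℚ] K) ≠ ⊥ := fun h1 ↦
    not_isUnramifiedAt_of_mem_sq hq P hq2 ((inertia_eq_bot_iff_isUnramifiedAt P).mp h1)
  obtain ⟨σ, hσ, hσ1⟩ := (P.inertia (K ≃ₐ[ℚ] K)).bot_or_exists_ne_one.resolve_left hI
  refine ⟨σ, a, b, hab, eq_swap_of_forall_ne (fun h1 ↦ hσ1 (hφ (by rw [h1, map_one]))) ?_⟩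
  intro i hi
  have hsub : y i - y (φ σ i) ∈ P := by
    rw [← neg_mem_iff, neg_sub, ← hy]
    exact hσ (y i)
  have hai : y a - y i ∈ P := by
    have h1 := P.sub_mem ha (affine_mem_of_sub_mem h hq P hqP hqu hi.symm hsub)
    refine (hP.mem_or_mem (x := (N : 𝓞 K)) ?_).resolve_left hNP
    convert h1 using 1
    ring
  by_contra! hne
  have h2 := second_derivative_mem_of_triple h P hab hne.1.symm hne.2.symm habP hai
  rcases hP.mem_or_mem h2 with h3 | h3
  · exact (hP.mem_or_mem h3).elim hNP' hNP
  · exact hroot a (hP.mem_of_pow_mem _ h3)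

end Primes

/-- Modulo `r` the trinomial is `X * (X ^ N - g)`, and Frobenius permutes the nonzero roots
cyclically. -/
theorem exists_transitive_fixing_of_frobenius {K : Type*} [Field K] [NumberField K] [IsGalois ℚ K]
    {N u r t : ℕ} {y : Fin (N + 1) → 𝓞 K} {φ : (K ≃ₐ[ℚ] K) →* Equiv.Perm (Fin (N + 1))}
    (hy : ∀ σ i, σ • y i = y (φ σ i)) (hN : N ≠ 0)
    (h : (twoParamTrinomial N ((-1) ^ N * u) r).map (Int.castRingHom (𝓞 K)) =
      ∏ i, (X - C (y i))) (hr : r.Prime) (hrN : ¬ r ∣ N) (hru : ¬ r ∣ u)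
    (hrΔ : ¬ r ∣ trinomialDisc N u r) (ht : r = N * t + 1) {g : ZMod r}
    (hg : IsPrimitiveRoot (g ^ t) N) (hA : (-1) ^ N * (u : ZMod r) = -g) :
    ∃ c, ∀ i j, i ≠ c → j ≠ c → ∃ σ, φ σ c = c ∧ φ σ i = j := by
  obtain ⟨P, hP, hrP⟩ := exists_isPrime_natCast_mem (K := K) hr
  have hP0 : P ≠ ⊥ := by rintro rfl; simp [hr.ne_zero] at hrP
  have := hP.isMaximal hP0
  let := Ideal.Quotient.field P
  have := finite_quotient_of_natCast_mem hr hrP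
  set π := Ideal.Quotient.mk P with hπ
  have hr0 : ((r : ℕ) : 𝓞 K ⧸ P) = 0 := by
    rw [← map_natCast π]
    exact Ideal.Quotient.eq_zero_iff_mem.mpr hrP
  have : CharP (𝓞 K ⧸ P) r := (CharP.charP_iff_prime_eq_zero hr).mpr hr0
  have : Fact r.Prime := ⟨hr⟩
  have : NeZero N := ⟨hN⟩
  let ψ : ZMod r →+* 𝓞 K ⧸ P := ZMod.castHom dvd_rfl _
  have heq {i j} (hij : π (y i) = π (y j)) : i = j :=
    eq_of_sub_mem hN h hr hrN hru hr P hrP hru hrΔ (Ideal.Quotient.eq.mp hij)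
  have hroot (i) : π (y i) * (π (y i) ^ N - ψ g) = 0 := by
    have h1 := congrArg π (trinomial_root h i)
    have h2 := congrArg ψ hA
    simp only [map_add, map_mul, map_pow, map_neg, map_one, map_natCast, map_zero,
      Int.cast_mul, Int.cast_pow, Int.cast_neg, Int.cast_one, Int.cast_natCast, hr0] at h1 h2
    linear_combination h1 - π (y i) * h2
  obtain ⟨c, hc⟩ : ∃ c, π (y c) = 0 := by
    have h1 := prod_sub_eq h 0
    have h2 : ∏ i, (0 - y i) ∈ P := by
      rw [h1]
      simpa using P.mul_mem_left _ hrP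
    obtain ⟨c, -, hc⟩ := Ideal.IsPrime.prod_mem_iff.mp h2
    exact ⟨c, Ideal.Quotient.eq_zero_iff_mem.mpr (by simpa using hc)⟩
  obtain ⟨σ, hσ⟩ := IsArithFrobAt.exists_of_isInvariant ℤ (K ≃ₐ[ℚ] K) P
  have hfrob (i) : π (y (φ σ i)) = ψ g ^ t * π (y i) := by
    have h1 := AlgHom.IsArithFrobAt.mk_apply hσ (y i)
    rw [card_quotient_under hr hrP] at h1
    rw [← hy]
    change π (σ • y i) = _ at h1
    rw [h1]
    change π (y i) ^ r = _
    rcases mul_eq_zero.mp (hroot i) with h2 | h2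
    · simp [h2, hr.ne_zero]
    · rw [congrArg (π (y i) ^ ·) ht, pow_succ, pow_mul, sub_eq_zero.mp h2]
  have hpow (m : ℕ) (i) : π (y (φ (σ ^ m) i)) = (ψ g ^ t) ^ m * π (y i) := by
    induction m with
    | zero => simp
    | succ m ih => rw [pow_succ', map_mul, Equiv.Perm.mul_apply, hfrob, ih, pow_succ', mul_assoc]
  refine ⟨c, fun i j hi hj ↦ ?_⟩
  have hne {i} (hi : i ≠ c) : π (y i) ≠ 0 := fun h1 ↦ hi (heq (h1.trans hc.symm))
  have hN' {i} (hi : i ≠ c) : π (y i) ^ N = ψ g :=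
    sub_eq_zero.mp ((mul_eq_zero.mp (hroot i)).resolve_left (hne hi))
  have hg0 : ψ g ≠ 0 := by
    rw [← hN' hi]
    exact pow_ne_zero _ (hne hi)
  have hprim : IsPrimitiveRoot (ψ g ^ t) N := by
    rw [← map_pow]
    exact hg.map_of_injective ψ.injective
  obtain ⟨m, -, hm⟩ := hprim.eq_pow_of_pow_eq_one (ξ := π (y j) / π (y i))
    (by rw [div_pow, hN' hi, hN' hj, div_self hg0])
  refine ⟨σ ^ m, heq ?_, heq ?_⟩
  · rw [hpow, hc, mul_zero]
  · rw [hpow, hm, div_mul_cancel₀ _ (hne hi)]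

theorem twoParamTrinomial_monic {N : ℕ} (hN : N ≠ 0) (A r : ℤ) :
    (twoParamTrinomial N A r).Monic := by
  unfold twoParamTrinomial
  monicity!
  exact fun h ↦ absurd h hN

theorem natDegree_twoParamTrinomial {N : ℕ} (hN : N ≠ 0) (A r : ℤ) :
    (twoParamTrinomial N A r).natDegree = N + 1 := by
  unfold twoParamTrinomial
  compute_degree!
  simp [hN]

theorem irreducible_twoParamTrinomial {N u r q : ℕ} (hN : N ≠ 0) (hq : q.Prime) (hqr : ¬ q ∣ r)
    (hqu : q ∣ u) (hqu2 : ¬ q ^ 2 ∣ u) :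
    Irreducible ((twoParamTrinomial N ((-1) ^ N * u) r).map (Int.castRingHom ℚ)) := by
  have hmonic := twoParamTrinomial_monic hN ((-1) ^ N * u) r
  rw [← IsPrimitive.Int.irreducible_iff_irreducible_map_cast hmonic.isPrimitive]
  have hqZ := Nat.prime_iff_prime_int.mp hq
  have hprime : (Ideal.span {(q : ℤ)}).IsPrime :=
    (Ideal.span_singleton_prime hqZ.ne_zero).mpr hqZ
  have hA : (q : ℤ) ∣ (-1) ^ N * u := (Int.natCast_dvd_natCast.mpr hqu).mul_left _
  refine irreducible_of_eisenstein_criterion hprime ?_ ?_ ?_ ?_ hmonic.isPrimitive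
  · rw [hmonic.leadingCoeff]
    exact (Ideal.ne_top_iff_one _).mp hprime.ne_top
  · intro m hm
    rw [degree_eq_natDegree hmonic.ne_zero, natDegree_twoParamTrinomial hN, Nat.cast_lt] at hm
    rw [Ideal.mem_span_singleton]
    simp only [twoParamTrinomial, coeff_add, coeff_X_pow, hm.ne, if_false, zero_add]
    rw [coeff_C_mul, coeff_C]
    refine dvd_add (hA.mul_right _) ?_
    split_ifs
    · exact hA.mul_right _
    · exact dvd_zero _
  · rw [degree_eq_natDegree hmonic.ne_zero, natDegree_twoParamTrinomial hN]
    exact_mod_cast N.succ_pos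
  · rw [Ideal.span_singleton_pow, Ideal.mem_span_singleton]
    simp only [twoParamTrinomial, coeff_add, coeff_X_pow, coeff_C_mul, coeff_X_zero, coeff_C_zero,
      mul_zero, add_zero, mul_assoc, N.succ_ne_zero.symm, if_false, zero_add]
    rw [(isUnit_neg_one.pow N).dvd_mul_left]
    intro h1
    have h2 : q ^ 2 ∣ u * r := by exact_mod_cast h1
    exact hqu2 (((hq.coprime_iff_not_dvd.mpr hqr).pow_left 2).dvd_of_dvd_mul_right h2)

theorem exists_mulEquiv_perm_and_discr {K : Type*} [Field K] [NumberField K] {N u r t q₀ q₁ : ℕ}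
    (hN : 2 ≤ N)
    [IsSplittingField ℚ K ((twoParamTrinomial N ((-1) ^ N * u) r).map (Int.castRingHom ℚ))]
    (hr : r.Prime) (hru : ¬ r ∣ u) (ht : r = N * t + 1) {g : ZMod r}
    (hg : IsPrimitiveRoot (g ^ t) N) (hA : (-1) ^ N * (u : ZMod r) = -g)
    (hq₀ : q₀.Prime) (hq₀r : ¬ q₀ ∣ r) (hq₀u : q₀ ∣ u) (hq₀u2 : ¬ q₀ ^ 2 ∣ u)
    (hq₁ : q₁.Prime) (hq₁r : ¬ q₁ ∣ r) (hq₁N : ¬ q₁ ∣ N) (hq₁N' : ¬ q₁ ∣ N + 1) (hq₁u : ¬ q₁ ∣ u)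
    (hq₁Δ : q₁ ∣ trinomialDisc N u r) (hq₁Δ2 : ¬ q₁ ^ 2 ∣ trinomialDisc N u r) :
    Nonempty ((K ≃ₐ[ℚ] K) ≃* Equiv.Perm (Fin (N + 1))) ∧
      (∀ q : ℕ, q.Prime → ¬ q ∣ u → ¬ q ∣ trinomialDisc N u r → ¬ (q : ℤ) ∣ discr K) ∧
      (∀ q : ℕ, q.Prime → ¬ q ∣ r → q ∣ u → ¬ q ^ 3 ∣ u → (q : ℤ) ∣ discr K) ∧
      ∀ q : ℕ, q.Prime → ¬ q ∣ r → ¬ q ∣ N → ¬ q ∣ N + 1 → ¬ q ∣ u → q ∣ trinomialDisc N u r →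
        ¬ q ^ 2 ∣ trinomialDisc N u r → (q : ℤ) ∣ discr K := by
  have hN0 : N ≠ 0 := by omega
  have hirr := irreducible_twoParamTrinomial (r := r) hN0 hq₀ hq₀r hq₀u hq₀u2
  have : IsGalois ℚ K := IsGalois.of_separable_splitting_field hirr.separable
  obtain ⟨y, φ, h, hφ, hy, htrans⟩ := exists_roots_and_permHom (K := K)
    (twoParamTrinomial_monic hN0 ((-1) ^ N * u) r) (natDegree_twoParamTrinomial hN0 _ _) hirr
  have hrN : ¬ r ∣ N := fun h1 ↦ hr.one_lt.ne' (Nat.dvd_one.mp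
    ((Nat.dvd_add_right (h1.mul_right t)).mp (dvd_of_eq ht)))
  have hrΔ : ¬ r ∣ trinomialDisc N u r := by
    rw [trinomialDisc, Nat.dvd_add_right ((dvd_pow_self r hN0).mul_left _), hr.dvd_mul]
    exact not_or.mpr ⟨fun h1 ↦ hrN (hr.dvd_of_dvd_pow h1), hru⟩
  refine ⟨?_, fun q hq hqu hqΔ ↦ not_dvd_discr_of_not_dvd hφ hy hN0 h hr hrN hru hq hqu hqΔ,
    fun q hq hqr hqu hqu3 ↦ dvd_discr_of_dvd h hN hq hqr hqu hqu3,
    fun q hq hqr hqN hqN' hqu hqΔ hqΔ2 ↦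
      (exists_swap_of_dvd_trinomialDisc hφ hy hN0 h hq hqr hqN hqN' hqu hqΔ hqΔ2).1⟩
  obtain ⟨-, σ, a, b, hab, hσ⟩ :=
    exists_swap_of_dvd_trinomialDisc hφ hy hN0 h hq₁ hq₁r hq₁N hq₁N' hq₁u hq₁Δ hq₁Δ2
  obtain ⟨c, hc⟩ := exists_transitive_fixing_of_frobenius hy hN0 h hr hrN hru hrΔ ht hg hA
  have htop : φ.range = ⊤ := by
    refine eq_top_of_swap_mem_of_transitive φ.range (fun i j ↦ ?_) hab ⟨σ, hσ⟩ c fun i j hi hj ↦ ?_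
    · obtain ⟨τ, hτ⟩ := htrans i j
      exact ⟨φ τ, ⟨τ, rfl⟩, hτ⟩
    · obtain ⟨τ, hτ⟩ := hc i j hi hj
      exact ⟨φ τ, ⟨τ, rfl⟩, hτ⟩
  exact ⟨MulEquiv.ofBijective φ ⟨hφ, MonoidHom.range_eq_top.mp htop⟩⟩

theorem card_filter_sq_dvd_le {a b q : ℕ} (hq : 0 < q) (hqb : q.Coprime b) (X : ℕ) :
    ((Finset.range X).filter fun x ↦ q ^ 2 ∣ a + b * x).card ≤ X / q ^ 2 + 1 := by
  rcases ((Finset.range X).filter fun x ↦ q ^ 2 ∣ a + b * x).eq_empty_or_nonempty with h | ⟨x₁, h₁⟩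
  · simp [h]
  have hle : ((Finset.range X).filter fun x ↦ q ^ 2 ∣ a + b * x).card ≤
      X.count (· ≡ x₁ [MOD q ^ 2]) := by
    rw [Nat.count_eq_card_filter_range]
    refine Finset.card_le_card fun x hx ↦ ?_
    simp only [Finset.mem_filter] at h₁ hx ⊢
    refine ⟨hx.1, ?_⟩
    have h2 : a + b * x ≡ a + b * x₁ [MOD q ^ 2] :=
      ((Nat.modEq_zero_iff_dvd.mpr hx.2).trans (Nat.modEq_zero_iff_dvd.mpr h₁.2).symm)
    exact Nat.ModEq.cancel_left_of_coprime (hqb.pow_left 2) (Nat.ModEq.add_left_cancel' a h2)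
  refine hle.trans ?_
  rw [Nat.count_modEq_card _ (pow_pos hq 2)]
  split_ifs <;> omega

theorem card_filter_not_squarefree_le {a b T X : ℕ} (hab : a.Coprime b) (hb : 6 ∣ b)
    (hT : 4 ≤ T) (hX : a + b * X ≤ T ^ 2) :
    (((Finset.range X).filter fun x ↦ ¬ Squarefree (a + b * x)).card : ℚ) ≤ X / 4 + (T - 4) := by
  have hsub : ((Finset.range X).filter fun x ↦ ¬ Squarefree (a + b * x)) ⊆
      ((Finset.Ioc 4 T).filter fun q ↦ q.Coprime b).biUnion
        fun q ↦ (Finset.range X).filter fun x ↦ q ^ 2 ∣ a + b * x := by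
    intro x hx
    simp only [Finset.mem_filter, Finset.mem_range, Finset.mem_biUnion, Finset.mem_Ioc] at hx ⊢
    obtain ⟨hxX, hsq⟩ := hx
    rw [Nat.squarefree_iff_prime_squarefree] at hsq
    push Not at hsq
    obtain ⟨q, hq, hdvd⟩ := hsq
    have hqb : ¬ q ∣ b := fun h ↦ by
      have h1 : q ∣ a := (Nat.dvd_add_left (h.mul_right x)).mp ((dvd_mul_right q q).trans hdvd)
      exact hq.one_lt.ne' (Nat.dvd_one.mp (hab ▸ Nat.dvd_gcd h1 h))
    have h5 : 4 < q := by
      have h2 : q ≠ 2 := by rintro rfl; exact hqb (dvd_trans (by norm_num) hb)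
      have h3 : q ≠ 3 := by rintro rfl; exact hqb (dvd_trans (by norm_num) hb)
      have h4 : q ≠ 4 := by rintro rfl; exact absurd hq (by norm_num)
      have := hq.two_le
      omega
    have ha0 : 0 < a := by
      rcases Nat.eq_zero_or_pos a with rfl | h
      · have : b = 1 := by simpa using hab
        omega
      · exact h
    refine ⟨q, ⟨⟨h5, ?_⟩, (hq.coprime_iff_not_dvd).mpr hqb⟩, hxX, by rwa [pow_two]⟩
    have h6 := Nat.le_of_dvd (by omega) hdvd
    have h7 : b * x ≤ b * X := Nat.mul_le_mul_left b hxX.le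
    nlinarith
  calc (((Finset.range X).filter fun x ↦ ¬ Squarefree (a + b * x)).card : ℚ)
      ≤ ∑ q ∈ (Finset.Ioc 4 T).filter fun q ↦ q.Coprime b, ((X / q ^ 2 + 1 : ℕ) : ℚ) := by
        rw [← Nat.cast_sum, Nat.cast_le]
        refine (Finset.card_le_card hsub).trans (Finset.card_biUnion_le.trans ?_)
        refine Finset.sum_le_sum fun q hq ↦ ?_
        simp only [Finset.mem_filter, Finset.mem_Ioc] at hq
        exact card_filter_sq_dvd_le (by omega) hq.2 X
    _ ≤ ∑ q ∈ Finset.Ioc 4 T, (X * ((q : ℚ) ^ 2)⁻¹ + 1) := by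
        refine (Finset.sum_le_sum_of_subset_of_nonneg (Finset.filter_subset _ _)
          fun _ _ _ ↦ by positivity).trans (Finset.sum_le_sum fun q _ ↦ ?_)
        push_cast
        gcongr
        rw [← div_eq_mul_inv]
        exact_mod_cast Nat.cast_div_le (α := ℚ) (m := X) (n := q ^ 2)
    _ = X * ∑ q ∈ Finset.Ioc 4 T, ((q : ℚ) ^ 2)⁻¹ + (T - 4) := by
        rw [Finset.sum_add_distrib, Finset.mul_sum]
        simp [Nat.cast_sub hT]
    _ ≤ X / 4 + (T - 4) := by
        have h1 := sum_Ioc_inv_sq_le_sub (α := ℚ) (by norm_num : 4 ≠ 0) hT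
        have h2 : (0 : ℚ) ≤ (T : ℚ)⁻¹ := by positivity
        have h3 : ∑ q ∈ Finset.Ioc 4 T, ((q : ℚ) ^ 2)⁻¹ ≤ 1 / 4 := by
          push_cast at h1
          linarith
        have h4 := mul_le_mul_of_nonneg_left h3 (Nat.cast_nonneg (α := ℚ) X)
        linarith

/-- Two linear forms whose only possible square divisors are prime to `6` are simultaneously
squarefree somewhere. -/
theorem exists_squarefree_pair {a₁ b₁ a₂ b₂ : ℕ} (h₁ : a₁.Coprime b₁) (h₂ : a₂.Coprime b₂)
    (hb₁ : 6 ∣ b₁) (hb₂ : 6 ∣ b₂) (hb₁0 : 0 < b₁) (hb₂0 : 0 < b₂) :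
    ∃ x, Squarefree (a₁ + b₁ * x) ∧ Squarefree (a₂ + b₂ * x) := by
  set M := a₁ + b₁ + a₂ + b₂ with hM
  have hT : 4 ≤ 5 * M := by omega
  have hc₁ := card_filter_not_squarefree_le (X := 25 * M) h₁ hb₁ hT (by nlinarith)
  have hc₂ := card_filter_not_squarefree_le (X := 25 * M) h₂ hb₂ hT (by nlinarith)
  by_contra! hno
  have hcov : Finset.range (25 * M) ⊆
      ((Finset.range (25 * M)).filter fun x ↦ ¬ Squarefree (a₁ + b₁ * x)) ∪
        (Finset.range (25 * M)).filter fun x ↦ ¬ Squarefree (a₂ + b₂ * x) := by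
    intro x hx
    rw [Finset.mem_union, Finset.mem_filter, Finset.mem_filter]
    by_cases h : Squarefree (a₁ + b₁ * x)
    · exact Or.inr ⟨hx, hno x h⟩
    · exact Or.inl ⟨hx, h⟩
  have hle := (Finset.card_le_card hcov).trans (Finset.card_union_le _ _)
  rw [Finset.card_range] at hle
  have hle' := (Nat.cast_le (α := ℚ)).mpr hle
  push_cast at hle' hc₁ hc₂
  have : (0 : ℚ) ≤ M := by positivity
  linarith

theorem exists_mem_one_two {c d : ℕ} (hcd : c.Coprime d) (hodd : Odd (c + d)) {q : ℕ}
    (hq : q.Prime) : ∃ v, ¬ q ∣ v ∧ ¬ q ∣ c + d * v := by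
  by_cases h : q ∣ c + d
  · have h2 : q ≠ 2 := by
      rintro rfl
      exact (Nat.not_even_iff_odd.mpr hodd) (even_iff_two_dvd.mpr h)
    refine ⟨2, fun h' ↦ h2 ((Nat.prime_dvd_prime_iff_eq hq Nat.prime_two).mp h'), fun h3 ↦ ?_⟩
    have h4 : q ∣ d := by
      have : c + d * 2 = c + d + d := by ring
      rw [this] at h3
      exact (Nat.dvd_add_right h).mp h3
    have h5 : q ∣ c := (Nat.dvd_add_left h4).mp h
    exact hq.one_lt.ne' (Nat.dvd_one.mp (hcd ▸ Nat.dvd_gcd h5 h4))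
  · exact ⟨1, fun h' ↦ hq.one_lt.ne' (Nat.dvd_one.mp h'), by simpa using h⟩

/-- Two coprime linear forms are simultaneously squarefree at an argument with prescribed
admissible residues modulo finitely many primes. -/
theorem exists_squarefree_sieve {c d : ℕ} (hd : 0 < d) (hcd : c.Coprime d) (S : Finset ℕ)
    (hS : ∀ q ∈ S, q.Prime) (h2 : 2 ∈ S) (h3 : 3 ∈ S) (v : ℕ → ℕ)
    (hv : ∀ q ∈ S, ¬ q ∣ v q ∧ ¬ q ∣ c + d * v q) :
    ∃ s, 1 < s ∧ Squarefree s ∧ Squarefree (c + d * s) ∧ ∀ q ∈ S, s ≡ v q [MOD q] := by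
  set M := ∏ q ∈ S, q with hM
  have hM0 : 0 < M := Finset.prod_pos fun q hq ↦ (hS q hq).pos
  have hdvd : ∀ q ∈ S, q ∣ M := fun q hq ↦ Finset.dvd_prod_of_mem _ hq
  have h6 : 6 ∣ M := Nat.Coprime.mul_dvd_of_dvd_of_dvd (by norm_num) (hdvd 2 h2) (hdvd 3 h3)
  obtain ⟨s₁, hs₁⟩ := Nat.chineseRemainderOfFinset v id S (fun q hq ↦ (hS q hq).ne_zero)
    fun q hq q' hq' hne ↦ (Nat.coprime_primes (hS q hq) (hS q' hq')).mpr hne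
  have hs₀ : ∀ q ∈ S, s₁ + M ≡ v q [MOD q] := fun q hq ↦ by
    simpa using (hs₁ q hq).add (Nat.modEq_zero_iff_dvd.mpr (hdvd q hq))
  set s₀ := s₁ + M with hs₀'
  have hM6 := Nat.le_of_dvd hM0 h6
  have hcop₁ : s₀.Coprime M := Nat.Coprime.prod_right fun q hq ↦ by
    rw [Nat.coprime_comm, (hS q hq).coprime_iff_not_dvd, (hs₀ q hq).dvd_iff dvd_rfl]
    exact (hv q hq).1
  have hcop₂ : (c + d * s₀).Coprime M := Nat.Coprime.prod_right fun q hq ↦ by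
    rw [Nat.coprime_comm, (hS q hq).coprime_iff_not_dvd,
      (((hs₀ q hq).mul_left d).add_left c).dvd_iff dvd_rfl]
    exact (hv q hq).2
  have hcop₃ : (c + d * s₀).Coprime d := by simpa using hcd
  obtain ⟨x, hx₁, hx₂⟩ := exists_squarefree_pair hcop₁ (hcop₃.mul_right hcop₂) h6
    (h6.mul_left d) hM0 (Nat.mul_pos hd hM0)
  refine ⟨s₀ + M * x, by nlinarith, hx₁, ?_, fun q hq ↦ ?_⟩
  · convert hx₂ using 1
    ring
  · simpa using (hs₀ q hq).add (Nat.modEq_zero_iff_dvd.mpr ((hdvd q hq).mul_right x))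

theorem exists_mul_modEq {a m : ℕ} (ham : a.Coprime m) (hm : m ≠ 0) (b : ℕ) :
    ∃ v, a * v ≡ b [MOD m] := by
  have : NeZero m := ⟨hm⟩
  refine ⟨((a : ZMod m)⁻¹ * b).val, ?_⟩
  rw [← ZMod.natCast_eq_natCast_iff]
  push_cast
  rw [ZMod.natCast_zmod_val, ← mul_assoc, ZMod.coe_mul_inv_eq_one a ham, one_mul]

theorem exists_prime_and_primitiveRoot {N : ℕ} (hN : N ≠ 0) (B : ℕ) :
    ∃ r t w : ℕ, r.Prime ∧ B < r ∧ r = N * t + 1 ∧ ¬ r ∣ w ∧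
      IsPrimitiveRoot ((-((-1) ^ N * (w : ZMod r))) ^ t) N := by
  obtain ⟨r, hr, hB, hmod⟩ := Nat.exists_prime_gt_modEq_one B hN
  obtain ⟨t, ht⟩ := (Nat.modEq_iff_dvd' hr.one_lt.le).mp hmod.symm
  have : Fact r.Prime := ⟨hr⟩
  obtain ⟨g, hg⟩ := HasEnoughRootsOfUnity.exists_primitiveRoot (ZMod r) (r - 1)
  have hr1 := hr.one_lt
  have hr0 : 0 < r - 1 := by omega
  have hg0 : g ≠ 0 := hg.ne_zero hr0.ne'
  have hw : (((-((-1) ^ N * g)).val : ℕ) : ZMod r) = -((-1) ^ N * g) := ZMod.natCast_zmod_val _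
  have hsq : ((-1 : ZMod r) ^ N) * (-1) ^ N = 1 := by rw [← mul_pow]; simp
  refine ⟨r, t, (-((-1) ^ N * g)).val, hr, hB, by omega, ?_, ?_⟩
  · rw [← ZMod.natCast_eq_zero_iff, hw]
    simpa using hg0
  · have : -((-1) ^ N * -((-1) ^ N * g)) = g := by linear_combination g * hsq
    rw [hw, this]
    exact hg.pow hr0 (by rw [ht, mul_comm])

section Parameters

variable {N r : ℕ}

theorem trinomialDisc_coprime (hN : N ≠ 0) (hr : r.Prime) (hrN : ¬ r ∣ N) {u : ℕ}
    (hu : u.Coprime ((N + 1) * r)) :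
    (trinomialDisc N u r).Coprime u ∧ (trinomialDisc N u r).Coprime N ∧
      (trinomialDisc N u r).Coprime (N + 1) ∧ (trinomialDisc N u r).Coprime r := by
  have hu₁ : u.Coprime (N + 1) := hu.coprime_mul_right_right
  have hu₂ : u.Coprime r := hu.coprime_mul_left_right
  have hrN' : r.Coprime N := hr.coprime_iff_not_dvd.mpr hrN
  have hNN : (N + 1).Coprime N := by simp
  unfold trinomialDisc
  refine ⟨?_, ?_, ?_, ?_⟩
  · rw [Nat.coprime_add_mul_right_left]
    exact (hu₁.symm.pow_left _).mul_left (hu₂.symm.pow_left _)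
  · obtain ⟨m, rfl⟩ := Nat.exists_eq_succ_of_ne_zero hN
    rw [pow_succ (m.succ), mul_right_comm, Nat.coprime_add_mul_right_left]
    exact (hNN.pow_left _).mul_left (hrN'.pow_left _)
  · rw [pow_succ, mul_right_comm, add_comm, Nat.coprime_add_mul_right_left]
    exact (hNN.symm.pow_left _).mul_left hu₁
  · obtain ⟨m, rfl⟩ := Nat.exists_eq_succ_of_ne_zero hN
    rw [pow_succ r, ← mul_assoc, add_comm, Nat.coprime_add_mul_right_left]
    exact (hrN'.symm.pow_left _).mul_left hu₂

theorem odd_add_of_odd {a b : ℕ} (hN : N ≠ 0) (ha : Odd a) (hb : Odd b) :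
    Odd ((N + 1) ^ (N + 1) * a + N ^ N * b) := by
  rcases Nat.even_or_odd N with h | h
  · exact ((h.add_one.pow).mul ha).add_even ((h.pow_of_ne_zero hN).mul_right _)
  · exact ((h.add_one.pow_of_ne_zero N.succ_ne_zero).mul_right _).add_odd (h.pow.mul hb)

theorem exists_parameters (hN : 2 ≤ N) {p : ℕ} (hp : p.Prime) {k : ℤ} (hk : ¬ (p : ℤ) ∣ k)
    (hr : r.Prime) (hpr : p < r) (hNr : N + 1 < r) {w : ℕ} (hrw : ¬ r ∣ w) :
    ∃ l s, l.Prime ∧ 1 < s ∧ Squarefree s ∧ l.Coprime s ∧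
      Squarefree (trinomialDisc N (l ^ 2 * s) r) ∧ (l ^ 2 * s).Coprime ((N + 1) * r) ∧
      l ^ 2 * s ≡ w [MOD r] ∧
      ((l * s * trinomialDisc N (l ^ 2 * s) r : ℕ) : ℤ) ≡ k [ZMOD (p : ℤ)] := by
  have hN0 : N ≠ 0 := by omega
  have hrN : ¬ r ∣ N := fun h ↦ by have := Nat.le_of_dvd (by omega) h; omega
  set c := (N + 1) ^ (N + 1) * r ^ N with hc
  have hcN : c.Coprime N := by
    have hNN : (N + 1).Coprime N := by simp
    exact (hNN.pow_left _).mul_left ((hr.coprime_iff_not_dvd.mpr hrN).pow_left _)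
  have hro : Odd r := hr.odd_of_ne_two (by omega)
  have hodd₁ : Odd (c + N ^ N) := by simpa using odd_add_of_odd hN0 (hro.pow (n := N)) odd_one
  obtain ⟨v₀, hv₀, hv₀'⟩ := exists_mem_one_two (hcN.pow_right N) hodd₁ hp
  have : Fact p.Prime := ⟨hp⟩
  have hkp : (k : ZMod p) ≠ 0 := by rwa [Ne, ZMod.intCast_zmod_eq_zero_iff_dvd]
  rw [← ZMod.natCast_eq_zero_iff] at hv₀ hv₀'
  obtain ⟨l, hl, hlp, hlk⟩ := Nat.forall_exists_prime_gt_and_eq_mod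
    (a := (v₀ : ZMod p) * ((c + N ^ N * v₀ : ℕ) : ZMod p) * (k : ZMod p)⁻¹)
    (IsUnit.mk0 _ (mul_ne_zero (mul_ne_zero hv₀ hv₀') (inv_ne_zero hkp))) r
  have hlo : Odd l := hlp.odd_of_ne_two (by omega)
  have hlcop {m : ℕ} (hm0 : m ≠ 0) (hm : m ≤ r) : l.Coprime m :=
    hlp.coprime_iff_not_dvd.mpr fun h ↦ by have := Nat.le_of_dvd (by omega) h; omega
  set d := N ^ N * l ^ 2 with hd
  have hd0 : 0 < d := Nat.mul_pos (Nat.pow_pos (by omega)) (Nat.pow_pos hlp.pos)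
  have hcl : c.Coprime l := ((hlcop (by omega) (by omega)).symm.pow_left _).mul_left
    ((hlcop (by omega) le_rfl).symm.pow_left _)
  have hcd : c.Coprime d := (hcN.pow_right N).mul_right (hcl.pow_right 2)
  have hodd : Odd (c + d) := odd_add_of_odd hN0 hro.pow hlo.pow
  have hrc : r ∣ c := (dvd_pow_self r hN0).mul_left _
  have hres (q : ℕ) (hq : q.Prime) : ∃ v, (¬ q ∣ v ∧ ¬ q ∣ c + d * v) ∧
      (q = p → l ^ 2 * v ≡ v₀ [MOD p]) ∧ (q = r → l ^ 2 * v ≡ w [MOD r]) := by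
    by_cases hqp : q = p
    · subst hqp
      obtain ⟨v, hv⟩ := exists_mul_modEq ((hlcop hq.ne_zero hpr.le).pow_left 2) hq.ne_zero v₀
      refine ⟨v, ⟨fun h ↦ ?_, fun h ↦ ?_⟩, fun _ ↦ hv, fun h ↦ absurd h hpr.ne⟩
      · exact hv₀ ((ZMod.natCast_eq_zero_iff _ _).mpr
          ((hv.dvd_iff dvd_rfl).mp (h.mul_left _)))
      · refine hv₀' ((ZMod.natCast_eq_zero_iff _ _).mpr ?_)
        rw [hd, mul_assoc] at h
        exact (((hv.mul_left (N ^ N)).add_left c).dvd_iff dvd_rfl).mp h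
    · by_cases hqr : q = r
      · subst hqr
        obtain ⟨v, hv⟩ := exists_mul_modEq ((hlcop hq.ne_zero le_rfl).pow_left 2) hq.ne_zero w
        refine ⟨v, ⟨fun h ↦ ?_, fun h ↦ ?_⟩, fun h ↦ absurd h hqp, fun _ ↦ hv⟩
        · exact hrw ((hv.dvd_iff dvd_rfl).mp (h.mul_left _))
        · rw [Nat.dvd_add_right hrc, hd, mul_assoc, hq.dvd_mul, hv.dvd_iff dvd_rfl] at h
          exact h.elim (fun h ↦ hrN (hq.dvd_of_dvd_pow h)) hrw
      · obtain ⟨v, hv⟩ := exists_mem_one_two hcd hodd hq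
        exact ⟨v, hv, fun h ↦ absurd h hqp, fun h ↦ absurd h hqr⟩
  choose! v hv hvp hvr using hres
  let S : Finset ℕ := {2, 3, p, r, l} ∪ (N + 1).primeFactors
  have hS : ∀ q ∈ S, q.Prime := by
    intro q hq
    simp only [S, Finset.mem_union, Finset.mem_insert, Finset.mem_singleton,
      Nat.mem_primeFactors] at hq
    rcases hq with (rfl | rfl | rfl | rfl | rfl) | hq
    exacts [Nat.prime_two, Nat.prime_three, hp, hr, hlp, hq.1]
  obtain ⟨s, hs1, hs, hΔ, hsS⟩ := exists_squarefree_sieve hd0 hcd S hS (by simp [S]) (by simp [S]) v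
    fun q hq ↦ hv q (hS q hq)
  have hscop {q : ℕ} (hq : q ∈ S) : q.Coprime s := by
    rw [(hS q hq).coprime_iff_not_dvd, (hsS q hq).dvd_iff dvd_rfl]
    exact (hv q (hS q hq)).1
  have hΔ' : trinomialDisc N (l ^ 2 * s) r = c + d * s := by
    rw [trinomialDisc, hc, hd, mul_assoc]
  have hsr := ((hsS r (by simp [S])).mul_left (l ^ 2)).trans (hvr r hr rfl)
  have hsp := ((hsS p (by simp [S])).mul_left (l ^ 2)).trans (hvp p hp rfl)
  refine ⟨l, s, hlp, hs1, hs, hscop (by simp [S]), hΔ' ▸ hΔ, ?_, hsr, ?_⟩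
  · refine Nat.Coprime.mul_left ?_ (Nat.Coprime.mul_right ?_ (hscop (by simp [S])).symm)
    · exact (hlcop (by omega) hNr.le).mul_right (hlcop (by omega) le_rfl) |>.pow_left 2
    · refine Nat.coprime_of_dvd fun q hq h1 h2 ↦ ?_
      exact (hq.coprime_iff_not_dvd.mp (hscop (by simp [S, hq, h2]))) h1
  · rw [← ZMod.intCast_eq_intCast_iff]
    rw [← ZMod.natCast_eq_natCast_iff] at hsp
    have hl0 : (l : ZMod p) ≠ 0 := by
      rw [Ne, ZMod.natCast_eq_zero_iff, ← hp.coprime_iff_not_dvd]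
      exact (hlcop hp.ne_zero hpr.le).symm
    refine mul_left_cancel₀ hl0 ?_
    have h1 : (l : ZMod p) * k = v₀ * (c + N ^ N * v₀ : ℕ) := by
      rw [hlk, mul_assoc, inv_mul_cancel₀ hkp, mul_one]
    rw [h1, hΔ', hd]
    push_cast at hsp ⊢
    rw [← hsp]
    ring

end Parameters

theorem exists_numberField_of_parameters {N u r t q₀ q₁ : ℕ} (hN : 2 ≤ N) (hr : r.Prime)
    (hru : ¬ r ∣ u) (ht : r = N * t + 1)
    (hg : IsPrimitiveRoot ((-((-1) ^ N * (u : ZMod r))) ^ t) N)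
    (hq₀ : q₀.Prime) (hq₀r : ¬ q₀ ∣ r) (hq₀u : q₀ ∣ u) (hq₀u2 : ¬ q₀ ^ 2 ∣ u)
    (hq₁ : q₁.Prime) (hq₁r : ¬ q₁ ∣ r) (hq₁N : ¬ q₁ ∣ N) (hq₁N' : ¬ q₁ ∣ N + 1) (hq₁u : ¬ q₁ ∣ u)
    (hq₁Δ : q₁ ∣ trinomialDisc N u r) (hq₁Δ2 : ¬ q₁ ^ 2 ∣ trinomialDisc N u r) :
    ∃ (a b : ℚ) (K : Type) (_ : Field K) (_ : NumberField K),
      (X ^ (N + 1) + C a * X + C b : ℚ[X]).Separable ∧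
      IsSplittingField ℚ K (X ^ (N + 1) + C a * X + C b) ∧
      Nonempty ((K ≃ₐ[ℚ] K) ≃* Equiv.Perm (Fin (N + 1))) ∧
      (∀ q : ℕ, q.Prime → ¬ q ∣ u → ¬ q ∣ trinomialDisc N u r → ¬ (q : ℤ) ∣ discr K) ∧
      (∀ q : ℕ, q.Prime → ¬ q ∣ r → q ∣ u → ¬ q ^ 3 ∣ u → (q : ℤ) ∣ discr K) ∧
      ∀ q : ℕ, q.Prime → ¬ q ∣ r → ¬ q ∣ N → ¬ q ∣ N + 1 → ¬ q ∣ u → q ∣ trinomialDisc N u r →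
        ¬ q ^ 2 ∣ trinomialDisc N u r → (q : ℤ) ∣ discr K := by
  have hF : (twoParamTrinomial N ((-1) ^ N * u) r).map (Int.castRingHom ℚ) =
      X ^ (N + 1) + C (((-1) ^ N * u : ℤ) : ℚ) * X + C (((-1) ^ N * u * r : ℤ) : ℚ) := by
    simp [twoParamTrinomial]
  let F := (twoParamTrinomial N ((-1) ^ N * u) r).map (Int.castRingHom ℚ)
  have hsf : IsSplittingField ℚ F.SplittingField F := by
    convert IsSplittingField.splittingField F
    exact Subsingleton.elim _ _
  have hnf : NumberField F.SplittingField :=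
    { to_finiteDimensional := IsSplittingField.finiteDimensional F.SplittingField F }
  refine ⟨((-1) ^ N * u : ℤ), ((-1) ^ N * u * r : ℤ), F.SplittingField, inferInstance, hnf, ?_,
    by rwa [← hF], exists_mulEquiv_perm_and_discr hN hr hru ht hg (neg_neg _).symm hq₀ hq₀r hq₀u
      hq₀u2 hq₁ hq₁r hq₁N hq₁N' hq₁u hq₁Δ hq₁Δ2⟩
  rw [← hF]
  exact (irreducible_twoParamTrinomial (by omega) hq₀ hq₀r hq₀u hq₀u2).separable

theorem reducedDiscr_eq_of_squarefree {K : Type*} [Field K] [NumberField K] {m : ℕ}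
    (hm : Squarefree m) (h : ∀ q : ℕ, q.Prime → ((q : ℤ) ∣ discr K ↔ q ∣ m)) :
    reducedDiscr K = m := by
  have : (discr K).natAbs.primeFactors = m.primeFactors := by
    ext q
    rw [Nat.mem_primeFactors, Nat.mem_primeFactors]
    refine ⟨fun ⟨hq, hd, _⟩ ↦ ⟨hq, (h q hq).mp (Int.natCast_dvd.mpr hd), hm.ne_zero⟩,
      fun ⟨hq, hd, _⟩ ↦ ⟨hq, Int.natCast_dvd.mp ((h q hq).mpr hd), ?_⟩⟩
    exact Int.natAbs_ne_zero.mpr (discr_ne_zero K)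
  rw [reducedDiscr, this, Nat.prod_primeFactors_of_squarefree hm]

theorem dvd_reducedDiscr {K : Type*} [Field K] [NumberField K] {q : ℕ} (hq : q.Prime)
    (h : (q : ℤ) ∣ discr K) : q ∣ reducedDiscr K :=
  Finset.dvd_prod_of_mem _ (Nat.mem_primeFactors.mpr
    ⟨hq, Int.natCast_dvd.mp h, Int.natAbs_ne_zero.mpr (discr_ne_zero K)⟩)

theorem not_sq_dvd_of_modEq {q m : ℕ} (hq : q.Prime) (h : m ≡ q [MOD q ^ 2]) :
    q ∣ m ∧ ¬ q ^ 2 ∣ m := by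
  refine ⟨(h.dvd_iff (dvd_pow_self q two_ne_zero)).mpr dvd_rfl, fun h1 ↦ ?_⟩
  have h2 := Nat.le_of_dvd hq.pos ((h.dvd_iff dvd_rfl).mp h1)
  have := hq.one_lt
  nlinarith

theorem exists_parameters_of_dvd {N : ℕ} (hN : 2 ≤ N) {p r : ℕ} (hp : p.Prime)
    (hr : r.Prime) (hpr : p < r) (hNr : N + 1 < r) {w : ℕ} :
    ∃ u q, q.Prime ∧ r < q ∧ ¬ q ∣ u ∧ q ∣ trinomialDisc N u r ∧ ¬ q ^ 2 ∣ trinomialDisc N u r ∧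
      u ≡ w [MOD r] ∧ p ∣ u ∧ ¬ p ^ 2 ∣ u := by
  obtain ⟨q, hqr, hq⟩ := Nat.exists_infinite_primes (r + 1)
  have hqcop {m : ℕ} (hm0 : m ≠ 0) (hm : m ≤ r) : q.Coprime m :=
    hq.coprime_iff_not_dvd.mpr fun h ↦ by have := Nat.le_of_dvd (by omega) h; omega
  have hpr' : p.Coprime r := (Nat.coprime_primes hp hr).mpr hpr.ne
  set c := (N + 1) ^ (N + 1) * r ^ N with hc
  have hq2 : q ^ 2 ≠ 0 := pow_ne_zero 2 hq.ne_zero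
  obtain ⟨v, hv⟩ := exists_mul_modEq (a := N ^ N) (m := q ^ 2)
    (((hqcop (by omega) (by omega)).symm.pow_left N).pow_right 2) hq2 (q + (q ^ 2 - 1) * c)
  obtain ⟨x, hx₁, hx₂⟩ := Nat.chineseRemainder (hpr'.pow_left 2) p w
  obtain ⟨u, hu₁, hu₂⟩ := Nat.chineseRemainder (n := p ^ 2 * r) (m := q ^ 2)
    ((((hqcop hp.ne_zero hpr.le).symm.pow_left 2).mul_left
      (hqcop hr.ne_zero le_rfl).symm).pow_right 2) x v
  have hup : u ≡ p [MOD p ^ 2] := (hu₁.of_mul_right r).trans hx₁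
  have hur : u ≡ w [MOD r] := (hu₁.of_mul_left (p ^ 2)).trans hx₂
  have hΔ : trinomialDisc N u r ≡ q [MOD q ^ 2] := by
    have h1 := ((hu₂.mul_left (N ^ N)).trans hv).add_left c
    refine h1.trans ?_
    have h2 : c + (q + (q ^ 2 - 1) * c) = q + q ^ 2 * c := by
      obtain ⟨m, hm⟩ := Nat.exists_eq_succ_of_ne_zero hq2
      rw [hm, Nat.succ_sub_one, Nat.succ_eq_add_one]
      ring
    rw [h2]
    simp [Nat.ModEq]
  obtain ⟨hΔ₁, hΔ₂⟩ := not_sq_dvd_of_modEq hq hΔ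
  refine ⟨u, q, hq, hqr, fun h ↦ ?_, hΔ₁, hΔ₂, hur, not_sq_dvd_of_modEq hp hup⟩
  rw [trinomialDisc, Nat.dvd_add_left (h.mul_left _)] at hΔ₁
  exact hq.coprime_iff_not_dvd.mp (((hqcop (by omega) hNr.le).pow_right _).mul_right
    ((hqcop (by omega) le_rfl).pow_right _)) hΔ₁

theorem stmt_13 (n : ℕ) (hn : 3 ≤ n) (p : ℕ) (hp : p.Prime) (k : ℤ) :
    ∃ (a b : ℚ) (K : Type) (_ : Field K) (_ : NumberField K),
      (X ^ n + C a * X + C b : ℚ[X]).Separable ∧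
      IsSplittingField ℚ K (X ^ n + C a * X + C b) ∧
      Nonempty ((K ≃ₐ[ℚ] K) ≃* Equiv.Perm (Fin n)) ∧
      (reducedDiscr K : ℤ) ≡ k [ZMOD (p : ℤ)] := by
  obtain ⟨N, rfl⟩ : ∃ N, n = N + 1 := ⟨n - 1, by omega⟩
  have hN : 2 ≤ N := by omega
  obtain ⟨r, t, w, hr, hB, ht, hrw, hg⟩ :=
    exists_prime_and_primitiveRoot (show N ≠ 0 by omega) (p + N + 1)
  have hnot {q m : ℕ} (hm0 : 0 < m) (hm : m < q) : ¬ q ∣ m := fun h ↦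
    absurd (Nat.le_of_dvd hm0 h) (by omega)
  have hprime {q : ℕ} (hq : q.Prime) (hne : q ≠ r) : ¬ q ∣ r := fun h ↦
    hne ((Nat.prime_dvd_prime_iff_eq hq hr).mp h)
  by_cases hk : (p : ℤ) ∣ k
  · obtain ⟨u, q, hq, hrq, hqu, hqΔ, hqΔ2, hur, hpu, hpu2⟩ :=
      exists_parameters_of_dvd hN hp hr (by omega) (by omega) (w := w)
    rw [← (ZMod.natCast_eq_natCast_iff _ _ _).mpr hur] at hg
    obtain ⟨a, b, K, hK, hK', hsep, hsplit, hgal, -, hu, -⟩ :=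
      exists_numberField_of_parameters hN hr
      (fun h ↦ hrw ((hur.dvd_iff dvd_rfl).mp h)) ht hg hp (hprime hp (by omega)) hpu hpu2 hq
      (hprime hq (by omega)) (hnot (by omega) (by omega)) (hnot (by omega) (by omega)) hqu hqΔ hqΔ2
    refine ⟨a, b, K, hK, hK', hsep, hsplit, hgal, ?_⟩
    have h1 := dvd_reducedDiscr hp (hu p hp (hprime hp (by omega)) hpu
      fun h ↦ hpu2 ((pow_dvd_pow p (by norm_num)).trans h))
    exact (Int.modEq_zero_iff_dvd.mpr (Int.natCast_dvd_natCast.mpr h1)).trans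
      (Int.modEq_zero_iff_dvd.mpr hk).symm
  · obtain ⟨l, s, hl, hs1, hs, hls, hΔ, hu, hur, hmod⟩ :=
      exists_parameters hN hp hk hr (by omega) (by omega) hrw
    rw [← (ZMod.natCast_eq_natCast_iff _ _ _).mpr hur] at hg
    obtain ⟨hΔu, hΔN, hΔN', hΔr⟩ :=
      trinomialDisc_coprime (by omega) hr (hnot (by omega) (by omega)) hu
    have hcop {q m : ℕ} (hq : q.Prime) (hqΔ : q ∣ trinomialDisc N (l ^ 2 * s) r)
        (h : (trinomialDisc N (l ^ 2 * s) r).Coprime m) : ¬ q ∣ m :=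
      hq.coprime_iff_not_dvd.mp (h.coprime_dvd_left hqΔ)
    have hnsq {q m : ℕ} (hq : q.Prime) (hm : Squarefree m) : ¬ q ^ 2 ∣ m := fun h ↦
      hq.not_isUnit (hm q (by rwa [← pow_two]))
    have hΔ1 : trinomialDisc N (l ^ 2 * s) r ≠ 1 := by
      have h1 : 0 < (N + 1) ^ (N + 1) * r ^ N := by have := hr.pos; positivity
      have h2 : 0 < N ^ N * (l ^ 2 * s) := by have := hl.pos; positivity
      rw [trinomialDisc]
      omega
    obtain ⟨q₀, hq₀, hq₀s⟩ := Nat.exists_prime_and_dvd hs1.ne'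
    obtain ⟨q₁, hq₁, hq₁Δ⟩ := Nat.exists_prime_and_dvd hΔ1
    have hur' {q : ℕ} (hq : q.Prime) (hqu : q ∣ l ^ 2 * s) : ¬ q ∣ r :=
      hq.coprime_iff_not_dvd.mp ((hu.coprime_mul_left_right).coprime_dvd_left hqu)
    have hl_of {q e : ℕ} (hq : q.Prime) (hqs : q ∣ s) (h : q ^ e ∣ l ^ 2 * s) : q ^ e ∣ s :=
      (((hls.coprime_dvd_right hqs).symm.pow_right 2).pow_left e).dvd_of_dvd_mul_left h
    obtain ⟨a, b, K, hK, hK', hsep, hsplit, hgal, h1, h2, h3⟩ := exists_numberField_of_parameters hN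
      hr (fun h ↦ hrw ((hur.dvd_iff dvd_rfl).mp h)) ht hg hq₀ (hur' hq₀ (hq₀s.mul_left _))
      (hq₀s.mul_left _) (fun h ↦ hnsq hq₀ hs (hl_of hq₀ hq₀s h)) hq₁ (hcop hq₁ hq₁Δ hΔr)
      (hcop hq₁ hq₁Δ hΔN) (hcop hq₁ hq₁Δ hΔN') (hcop hq₁ hq₁Δ hΔu) hq₁Δ (hnsq hq₁ hΔ)
    refine ⟨a, b, K, hK, hK', hsep, hsplit, hgal, ?_⟩
    rwa [reducedDiscr_eq_of_squarefree (m := l * s * trinomialDisc N (l ^ 2 * s) r)]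
    · rw [Nat.squarefree_mul_iff, Nat.squarefree_mul_iff]
      refine ⟨?_, ⟨hls, hl.squarefree, hs⟩, hΔ⟩
      exact (hΔu.coprime_dvd_right ⟨l, by ring⟩).symm
    · intro q hq
      constructor
      · contrapose!
        intro h
        rw [hq.dvd_mul, hq.dvd_mul] at h
        push Not at h
        refine h1 q hq ?_ h.2
        rw [hq.dvd_mul]
        exact not_or.mpr ⟨fun h' ↦ h.1.1 (hq.dvd_of_dvd_pow h'), h.1.2⟩
      · intro h
        rw [hq.dvd_mul, hq.dvd_mul] at h
        rcases h with (h | h) | h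
        · obtain rfl := (Nat.prime_dvd_prime_iff_eq hq hl).mp h
          have hu : q ∣ q ^ 2 * s := (dvd_pow_self q two_ne_zero).mul_right s
          refine h2 q hq (hur' hq hu) hu fun h' ↦ ?_
          rw [pow_succ] at h'
          exact hq.coprime_iff_not_dvd.mp hls (Nat.dvd_of_mul_dvd_mul_left (pow_pos hq.pos 2) h')
        · refine h2 q hq (hur' hq (h.mul_left _)) (h.mul_left _) fun h' ↦ ?_
          exact hnsq hq hs ((pow_dvd_pow q (by norm_num)).trans (hl_of hq h h'))
        · exact h3 q hq (hcop hq h hΔr) (hcop hq h hΔN) (hcop hq h hΔN') (hcop hq h hΔu) h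
            (hnsq hq hΔ)
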